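/- arXiv:0807.2231 — 3 statements merged into one kernel-verified Lean document; each statement's English description precedes it below -/
import Mathlib

section
/- Let T : [0,1) → [0,1) be a Borel measurable map, let μ be a T-invariant Borel probability measure on [0,1), and let α > 0. If there exists a Borel set M ⊆ [0,1) with μ(M) = 1 and dim_H(M) < α, then for μ-almost every x ∈ [0,1), liminf_{n→∞} n^(1/α) |T^n(x) − x| = 0. -/
open MeasureTheory Filter Set Matrix Topology

noncomputable section

/-- Keane's 4×4 matrix `A_{m,n}` with rows (0,0,1,1), (m−1,m,0,0), (n,n,n−1,n), (1,1,1,1). -/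
def Amat (m n : ℕ) : Matrix (Fin 4) (Fin 4) ℝ :=
  !![0, 0, 1, 1;
     (m : ℝ) - 1, (m : ℝ), 0, 0;
     (n : ℝ), (n : ℝ), (n : ℝ) - 1, (n : ℝ);
     1, 1, 1, 1]

/-- `B_k = A_{m_1,n_1} A_{m_2,n_2} ⋯ A_{m_k,n_k}` (sequences indexed from 1). -/
def Bmat (m n : ℕ → ℕ) (k : ℕ) : Matrix (Fin 4) (Fin 4) ℝ :=
  ((List.range k).map fun i => Amat (m (i + 1)) (n (i + 1))).prod

/-- `|v|₁`, the sum of the absolute values of the entries of `v`. -/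
def l1norm (v : Fin 4 → ℝ) : ℝ := ∑ i, |v i|

/-- `b_{k,i} = |B_k e_i|₁`; here columns are indexed from 0, so `e_i` is the
basis vector with a 1 in position `i` where `i : Fin 4` (e.g. the paper's `e_2` is `i = 1`). -/
def bnum (m n : ℕ → ℕ) (k : ℕ) (i : Fin 4) : ℝ := l1norm fun j => Bmat m n k j i

/-- `Ā_{m,n}(v) = A_{m,n} v / |A_{m,n} v|₁`. -/
def Abar (m n : ℕ) (v : Fin 4 → ℝ) : Fin 4 → ℝ :=
  (l1norm (Amat m n *ᵥ v))⁻¹ • (Amat m n *ᵥ v)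

/-- `barSeq m n k v = Ā_{m_1,n_1} Ā_{m_2,n_2} ⋯ Ā_{m_k,n_k} (v)`. -/
def barSeq (m n : ℕ → ℕ) : ℕ → (Fin 4 → ℝ) → Fin 4 → ℝ
  | 0, v => v
  | k + 1, v => barSeq m n k (Abar (m (k + 1)) (n (k + 1)) v)

/-- The paper's `e₂ = (0,1,0,0)ᵀ`. -/
def e2 : Fin 4 → ℝ := ![0, 1, 0, 0]

/-- The paper's `e₃ = (0,0,1,0)ᵀ`. -/
def e3 : Fin 4 → ℝ := ![0, 0, 1, 0]

/-- Keane's conditions: the sequences are positive integers, `3(n_k+1) ≤ m_k ≤ (n_{k+1}+1)/2`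
for all `k ≥ 1`, and `n_1 ≥ 10`. -/
def KeaneCond (m n : ℕ → ℕ) : Prop :=
  (∀ k, 1 ≤ k → 1 ≤ m k ∧ 1 ≤ n k) ∧
  (∀ k, 1 ≤ k → 3 * (n k + 1) ≤ m k ∧ 2 * m k ≤ n (k + 1) + 1) ∧
  10 ≤ n 1

/-- The permutation (4213) (one-indexed: π(1)=4, π(2)=2, π(3)=1, π(4)=3), written zero-indexed. -/
def kperm : Fin 4 → Fin 4 := ![3, 1, 0, 2]

/-- The 4-interval exchange transformation with length vector `l` and permutation (4213):
on `I_j = [l_1+⋯+l_{j−1}, l_1+⋯+l_j)` it is `x ↦ x − ∑_{k<j} l_k + ∑_{π(k')<π(j)} l_{k'}`. -/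
def iet (l : Fin 4 → ℝ) (x : ℝ) : ℝ :=
  if x < l 0 then
    x + ∑ k ∈ Finset.univ.filter (fun k => kperm k < kperm 0), l k
  else if x < l 0 + l 1 then
    x - l 0 + ∑ k ∈ Finset.univ.filter (fun k => kperm k < kperm 1), l k
  else if x < l 0 + l 1 + l 2 then
    x - (l 0 + l 1) + ∑ k ∈ Finset.univ.filter (fun k => kperm k < kperm 2), l k
  else
    x - (l 0 + l 1 + l 2) + ∑ k ∈ Finset.univ.filter (fun k => kperm k < kperm 3), l k

/-- The IET regarded as a self-map of `ℝ`, extended by the identity off `[0,1)`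
(a measure `μ` with `μ [0,1) = 1` then plays the role of a Borel measure on `[0,1)`). -/
def ietFull (l : Fin 4 → ℝ) (x : ℝ) : ℝ :=
  if x ∈ Set.Ico (0 : ℝ) 1 then iet l x else x

/-- If returns of a measurable set `W` to itself at times `m * N` with `m ≥ 1` only occur when
`c ≤ m * q`, then `c * μ W ≤ q`. -/
theorem mul_measureReal_le_of_forall_return {X : Type*} [MeasurableSpace X] {μ : Measure X}
    [IsProbabilityMeasure μ] {S : X → X} (hS : MeasurePreserving S μ μ) {W : Set X}
    (hW : MeasurableSet W) {c q : ℝ} (hq : 0 ≤ q)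
    (hret : ∀ x ∈ W, ∀ m : ℕ, 0 < m → S^[m] x ∈ W → c ≤ m * q) :
    c * μ.real W ≤ q := by
  rcases (measureReal_nonneg (μ := μ) (s := W)).eq_or_lt with h0 | h0
  · rw [← h0, mul_zero]
    exact hq
  have hlt : μ univ < ((⌊(μ.real W)⁻¹⌋₊ + 1 : ℕ) : ENNReal) * μ W := by
    rw [measure_univ, ← ofReal_measureReal (μ := μ) (s := W), ← ENNReal.ofReal_natCast,
      ← ENNReal.ofReal_mul (Nat.cast_nonneg _), ENNReal.one_lt_ofReal]
    have h := Nat.lt_floor_add_one (μ.real W)⁻¹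
    rw [inv_lt_iff_one_lt_mul₀ h0] at h
    push_cast
    linarith
  obtain ⟨x, hx, m, hm, hxm⟩ :=
    hS.exists_mem_iterate_mem_of_measure_univ_lt_mul_measure hW.nullMeasurableSet hlt
  have hm' : (m : ℝ) ≤ (μ.real W)⁻¹ :=
    (Nat.le_floor_iff (inv_nonneg.2 h0.le)).1 (Nat.lt_succ_iff.1 hm.2)
  have hc := hret x hx m hm.1 hxm
  calc c * μ.real W ≤ (m * q) * μ.real W := by gcongr
    _ ≤ ((μ.real W)⁻¹ * q) * μ.real W := by gcongr
    _ = q := by field_simp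

/-- The points whose orbit after time `N` returns no closer than `δ * n ^ (-1 / α)`. -/
def slowReturnSet (T : ℝ → ℝ) (α δ : ℝ) (N : ℕ) : Set ℝ :=
  {x | ∀ n : ℕ, N ≤ n → δ ≤ (n : ℝ) ^ (1 / α) * |T^[n] x - x|}

theorem measurableSet_slowReturnSet {T : ℝ → ℝ} (hT : Measurable T) (α δ : ℝ) (N : ℕ) :
    MeasurableSet (slowReturnSet T α δ N) := by
  unfold slowReturnSet
  simp only [ofPred_forall]
  refine MeasurableSet.iInter fun n => MeasurableSet.iInter fun _ => ?_
  have h : Measurable fun x => |T^[n] x - x| := ((hT.iterate n).sub measurable_id).norm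
  exact measurableSet_le measurable_const (measurable_const.mul h)

/-- On the slow-return set, `μ` is dominated by a multiple of Hausdorff measure. -/
theorem smul_restrict_slowReturnSet_le {T : ℝ → ℝ} {μ : Measure ℝ} [IsProbabilityMeasure μ]
    (hT : MeasurePreserving T μ μ) {α δ : ℝ} (hα : 0 < α) (hδ : 0 < δ) {N : ℕ} (hN : 0 < N) :
    ENNReal.ofReal (δ ^ α / N) • μ.restrict (slowReturnSet T α δ N) ≤ μH[α] := by
  refine Measure.le_hausdorffMeasure α _ 1 one_pos fun s hs => ?_
  set B := slowReturnSet T α δ N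
  have hB : MeasurableSet B := measurableSet_slowReturnSet hT.measurable α δ N
  set W := closure s ∩ B
  have hW : MeasurableSet W := isClosed_closure.measurableSet.inter hB
  have hfin : Metric.ediam (closure s) ≠ ⊤ := by
    rw [Metric.ediam_closure]
    exact (hs.trans_lt ENNReal.one_lt_top).ne
  set r := Metric.diam (closure s)
  have hr : 0 ≤ r := Metric.diam_nonneg
  have key : δ ^ α / N * μ.real W ≤ r ^ α := by
    refine mul_measureReal_le_of_forall_return (hT.iterate N) hW (by positivity) ?_
    intro x hx m hm hxm
    rw [← Function.iterate_mul] at hxm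
    have h1 : δ ≤ ((N * m : ℕ) : ℝ) ^ (1 / α) * |T^[N * m] x - x| :=
      hx.2 (N * m) (Nat.le_mul_of_pos_right N hm)
    have h2 : |T^[N * m] x - x| ≤ r := Metric.dist_le_diam_of_mem' hfin hxm.1 hx.1
    have h3 : δ ≤ ((N * m : ℕ) : ℝ) ^ (1 / α) * r := h1.trans (by gcongr)
    have h4 : δ ^ α ≤ N * m * r ^ α := by
      calc δ ^ α ≤ (((N * m : ℕ) : ℝ) ^ (1 / α) * r) ^ α := by gcongr
        _ = N * m * r ^ α := by
          rw [Real.mul_rpow (by positivity) hr, ← Real.rpow_mul (by positivity),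
            one_div_mul_cancel hα.ne', Real.rpow_one]
          push_cast
          rfl
    rw [div_le_iff₀ (by positivity)]
    linarith
  calc (ENNReal.ofReal (δ ^ α / N) • μ.restrict B) s
      ≤ ENNReal.ofReal (δ ^ α / N) * μ W := by
        rw [Measure.smul_apply, smul_eq_mul, Measure.restrict_apply' hB]
        gcongr
        exact inter_subset_inter_left _ subset_closure
    _ = ENNReal.ofReal (δ ^ α / N * μ.real W) := by
        rw [ENNReal.ofReal_mul (by positivity), ofReal_measureReal]
    _ ≤ ENNReal.ofReal (r ^ α) := ENNReal.ofReal_le_ofReal key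
    _ = Metric.ediam s ^ α := by
        rw [← ENNReal.ofReal_rpow_of_nonneg hr hα.le, ← Metric.ediam_closure]
        exact congrArg (· ^ α) (ENNReal.ofReal_toReal hfin)

theorem ae_notMem_slowReturnSet {T : ℝ → ℝ} {μ : Measure ℝ} [IsProbabilityMeasure μ]
    (hT : MeasurePreserving T μ μ) {α δ : ℝ} (hα : 0 < α) (hδ : 0 < δ) {N : ℕ} (hN : 0 < N)
    {M : Set ℝ} (hM : ∀ᵐ x ∂μ, x ∈ M) (hdim : dimH M < ENNReal.ofReal α) :
    ∀ᵐ x ∂μ, x ∉ slowReturnSet T α δ N := by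
  have hM0 : μH[α] M = 0 := by
    simpa [Real.coe_toNNReal α hα.le] using
      hausdorffMeasure_of_dimH_lt (d := α.toNNReal) hdim
  have h := (smul_restrict_slowReturnSet_le hT hα hδ hN M).trans_eq hM0
  rw [nonpos_iff_eq_zero, Measure.smul_apply, smul_eq_mul, mul_eq_zero,
    Measure.restrict_apply' (measurableSet_slowReturnSet hT.measurable α δ N)] at h
  have hc : ENNReal.ofReal (δ ^ α / N) ≠ 0 := by
    rw [Ne, ENNReal.ofReal_eq_zero, not_le]
    positivity
  filter_upwards [hM, measure_eq_zero_iff_ae_notMem.1 (h.resolve_left hc)] with x hx hx' hxB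
  exact hx' ⟨hx, hxB⟩

theorem liminf_eq_zero_of_frequently_lt {u : ℕ → ℝ} (h0 : ∀ n, 0 ≤ u n)
    (h : ∀ ε > 0, ∃ᶠ n in atTop, u n < ε) : liminf u atTop = 0 := by
  have hle : ∀ ε > 0, ∃ᶠ n in atTop, u n ≤ ε := fun ε hε => (h ε hε).mono fun _ => le_of_lt
  refine le_antisymm (le_of_forall_pos_le_add fun ε hε => ?_) ?_
  · rw [zero_add]
    exact liminf_le_of_frequently_le (hle ε hε) (isBoundedUnder_of ⟨0, h0⟩)
  · exact le_liminf_of_le (IsCoboundedUnder.of_frequently_le (hle 1 one_pos))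
      (Eventually.of_forall h0)

/-- Boshernitzan's theorem (Theorem 1.3 of [B2]): if `T : [0,1) → [0,1)` is Borel measurable,
`μ` is a `T`-invariant Borel probability measure, and there is a Borel set `M ⊆ [0,1)` with
`μ M = 1` and `dimH M < α`, then for `μ`-a.e. `x`, `liminf_n n^(1/α) |T^n(x) − x| = 0`. -/
theorem boshernitzan_recurrence (T : ℝ → ℝ) (hT : Measurable T)
    (hmaps : Set.MapsTo T (Set.Ico 0 1) (Set.Ico 0 1))
    (μ : Measure ℝ) (hμ : IsProbabilityMeasure μ) (hμsupp : μ (Set.Ico 0 1) = 1)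
    (hinv : ∀ E : Set ℝ, MeasurableSet E → μ (T ⁻¹' E) = μ E)
    (α : ℝ) (hα : 0 < α)
    (hdim : ∃ M : Set ℝ, MeasurableSet M ∧ M ⊆ Set.Ico 0 1 ∧ μ M = 1 ∧
      dimH M < ENNReal.ofReal α) :
    ∀ᵐ x ∂μ, Filter.liminf (fun nn : ℕ => (nn : ℝ) ^ (1 / α) * |T^[nn] x - x|) atTop = 0 := by
  obtain ⟨M, hM, -, hM1, hMdim⟩ := hdim
  have hpres : MeasurePreserving T μ μ :=
    ⟨hT, Measure.ext fun E hE => by rw [Measure.map_apply hT hE, hinv E hE]⟩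
  have hMae : ∀ᵐ x ∂μ, x ∈ M := mem_ae_iff_prob_eq_one hM |>.2 hM1
  have hae : ∀ᵐ x ∂μ, ∀ j N : ℕ, x ∉ slowReturnSet T α (1 / ((j : ℝ) + 1)) (N + 1) :=
    ae_all_iff.2 fun j => ae_all_iff.2 fun N =>
      ae_notMem_slowReturnSet hpres hα Nat.one_div_pos_of_nat N.succ_pos hMae hMdim
  filter_upwards [hae] with x hx
  refine liminf_eq_zero_of_frequently_lt (fun n => by positivity) fun ε hε => ?_
  obtain ⟨j, hj⟩ := exists_nat_one_div_lt hε
  refine frequently_atTop.2 fun N => ?_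
  have hxN := hx j N
  simp only [slowReturnSet, mem_ofPred_eq, not_forall, not_le] at hxN
  obtain ⟨n, hn, hlt⟩ := hxN
  exact ⟨n, by omega, hlt.trans hj⟩
end
end

section
/- Suppose the positive integer sequences (m_k), (n_k) satisfy Keane's conditions and that \bar A_{m_1,n_1}\cdots\bar A_{m_k,n_k}(e_3) converges as k → ∞ to a vector L. Then for every k ≥ 1 and every vector w ∈ ℝ⁴ with nonnegative entries satisfying B_k w = L, one has w_2/|w|_1 ≤ 2m_k/((n_{k+1}+1)(n_k+1)). -/
open MeasureTheory Filter Set Matrix Topology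

noncomputable section

/-- The cone of nonnegative vectors whose first two entries are at most `|v|₁ / (a + 1)`. -/
def smallCone (a : ℕ) : Set (Fin 4 → ℝ) :=
  {v | (∀ i, 0 ≤ v i) ∧ ((a : ℝ) + 1) * v 0 ≤ v 0 + v 1 + v 2 + v 3 ∧
    ((a : ℝ) + 1) * v 1 ≤ v 0 + v 1 + v 2 + v 3}

lemma Amat_mulVec (m n : ℕ) (v : Fin 4 → ℝ) :
    Amat m n *ᵥ v = ![v 2 + v 3, ((m : ℝ) - 1) * v 0 + m * v 1,
      n * v 0 + n * v 1 + ((n : ℝ) - 1) * v 2 + n * v 3, v 0 + v 1 + v 2 + v 3] := by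
  ext i
  fin_cases i <;> simp [Amat, Matrix.mulVec, dotProduct, Fin.sum_univ_four]

lemma Amat_det_isUnit (m n : ℕ) : IsUnit (Amat m n).det := by
  have h : (Amat m n).det = 1 := by
    simp [Amat, Matrix.det_succ_row_zero, Fin.sum_univ_succ, Fin.succAbove]
    ring
  rw [h]
  exact isUnit_one

lemma Bmat_succ (m n : ℕ → ℕ) (k : ℕ) :
    Bmat m n (k + 1) = Bmat m n k * Amat (m (k + 1)) (n (k + 1)) := by
  simp [Bmat, List.range_succ]

lemma Bmat_det_isUnit (m n : ℕ → ℕ) (k : ℕ) : IsUnit (Bmat m n k).det := by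
  induction k with
  | zero => simp [Bmat]
  | succ k ih =>
    rw [Bmat_succ, Matrix.det_mul]
    exact ih.mul (Amat_det_isUnit _ _)

lemma l1norm_nonneg (v : Fin 4 → ℝ) : 0 ≤ l1norm v :=
  Finset.sum_nonneg fun _ _ => abs_nonneg _

lemma smul_mem_smallCone {a : ℕ} {c : ℝ} (hc : 0 ≤ c) {v : Fin 4 → ℝ} (hv : v ∈ smallCone a) :
    c • v ∈ smallCone a := by
  obtain ⟨h, h0, h1⟩ := hv
  refine ⟨fun i => mul_nonneg hc (h i), ?_, ?_⟩ <;> simp only [Pi.smul_apply, smul_eq_mul]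
  · linarith [mul_le_mul_of_nonneg_left h0 hc]
  · linarith [mul_le_mul_of_nonneg_left h1 hc]

lemma isClosed_smallCone (a : ℕ) : IsClosed (smallCone a) := by
  have h : IsClosed {v : Fin 4 → ℝ | ∀ i, 0 ≤ v i} := by
    simp only [Set.ofPred_forall]
    exact isClosed_iInter fun i => isClosed_le continuous_const (continuous_apply i)
  have h' (i : Fin 4) :
      IsClosed {v : Fin 4 → ℝ | ((a : ℝ) + 1) * v i ≤ v 0 + v 1 + v 2 + v 3} :=
    isClosed_le (by fun_prop) (by fun_prop)
  exact h.inter ((h' 0).inter (h' 1))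

lemma e3_mem_smallCone (a : ℕ) : e3 ∈ smallCone a := by
  refine ⟨fun i => ?_, ?_, ?_⟩
  · fin_cases i <;> simp [e3]
  · simp [e3]
  · simp [e3]

lemma Amat_mulVec_mem_smallCone {m n a : ℕ} (hm : 1 ≤ m) (hn : 1 ≤ n) (ha : 2 * m ≤ a + 1)
    {v : Fin 4 → ℝ} (hv : v ∈ smallCone a) : Amat m n *ᵥ v ∈ smallCone n := by
  obtain ⟨h, h0, h1⟩ := hv
  have hm' : (1 : ℝ) ≤ m := by exact_mod_cast hm
  have hn' : (1 : ℝ) ≤ n := by exact_mod_cast hn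
  have ha' : 2 * (m : ℝ) ≤ a + 1 := by exact_mod_cast ha
  have p0 := h 0
  have p1 := h 1
  have p2 := h 2
  have p3 := h 3
  have q0 : 0 ≤ ((m : ℝ) - 1) * v 0 := mul_nonneg (by linarith) p0
  have q1 : 0 ≤ (m : ℝ) * v 1 := mul_nonneg (by linarith) p1
  have r0 := mul_le_mul_of_nonneg_right ha' p0
  have r1 := mul_le_mul_of_nonneg_right ha' p1
  have s0 : 0 ≤ (n : ℝ) * v 0 := mul_nonneg (by linarith) p0
  have s1 : 0 ≤ (n : ℝ) * v 1 := mul_nonneg (by linarith) p1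
  have s2 : 0 ≤ ((n : ℝ) - 1) * v 2 := mul_nonneg (by linarith) p2
  have s3 : 0 ≤ (n : ℝ) * v 3 := mul_nonneg (by linarith) p3
  have t : ((n : ℝ) + 1) * (((m : ℝ) - 1) * v 0 + m * v 1) ≤
      ((n : ℝ) + 1) * (v 0 + v 1 + v 2 + v 3) :=
    mul_le_mul_of_nonneg_left (by linarith) (by linarith)
  rw [Amat_mulVec]
  refine ⟨fun i => ?_, ?_, ?_⟩
  · fin_cases i <;> simp <;> linarith
  · simp
    linarith
  · simp
    linarith

lemma exists_barSeq_eq_smul (m n : ℕ → ℕ) (k : ℕ) (v : Fin 4 → ℝ) :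
    ∃ c : ℝ, 0 ≤ c ∧ barSeq m n k v = Bmat m n k *ᵥ (c • v) := by
  induction k generalizing v with
  | zero => exact ⟨1, zero_le_one, by simp [barSeq, Bmat]⟩
  | succ k ih =>
    obtain ⟨c, hc, h⟩ := ih (Abar (m (k + 1)) (n (k + 1)) v)
    refine ⟨c * (l1norm (Amat (m (k + 1)) (n (k + 1)) *ᵥ v))⁻¹,
      mul_nonneg hc (inv_nonneg.2 (l1norm_nonneg _)), ?_⟩
    rw [barSeq, h, Bmat_succ, ← Matrix.mulVec_mulVec, Abar, smul_smul, Matrix.mulVec_smul _ _ v]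

lemma exists_barSeq_eq_mulVec {m n : ℕ → ℕ} (hK : KeaneCond m n) (k N : ℕ) {v : Fin 4 → ℝ}
    (hv : v ∈ smallCone (n (k + N + 1))) :
    ∃ x ∈ smallCone (n (k + 1)), barSeq m n (k + N) v = Bmat m n k *ᵥ x := by
  induction N generalizing v with
  | zero =>
    obtain ⟨c, hc, h⟩ := exists_barSeq_eq_smul m n k v
    exact ⟨c • v, smul_mem_smallCone hc hv, h⟩
  | succ N ih =>
    have hpos := hK.1 (k + N + 1) (by omega)
    exact ih (smul_mem_smallCone (inv_nonneg.2 (l1norm_nonneg _))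
      (Amat_mulVec_mem_smallCone hpos.1 hpos.2 (hK.2.1 (k + N + 1) (by omega)).2 hv))

lemma mem_smallCone_of_Bmat_mulVec_eq {m n : ℕ → ℕ} (hK : KeaneCond m n) {L : Fin 4 → ℝ}
    (hconv : Tendsto (fun k => barSeq m n k e3) atTop (𝓝 L)) {k : ℕ} {w : Fin 4 → ℝ}
    (hw : Bmat m n k *ᵥ w = L) : w ∈ smallCone (n (k + 1)) := by
  have hinv (x : Fin 4 → ℝ) : (Bmat m n k)⁻¹ *ᵥ (Bmat m n k *ᵥ x) = x := by
    rw [Matrix.mulVec_mulVec, Matrix.nonsing_inv_mul _ (Bmat_det_isUnit m n k), Matrix.one_mulVec]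
  have hlim : Tendsto (fun N => (Bmat m n k)⁻¹ *ᵥ barSeq m n N e3) atTop (𝓝 w) := by
    have hcont : Continuous fun x : Fin 4 → ℝ => (Bmat m n k)⁻¹ *ᵥ x := by fun_prop
    have h := (hcont.tendsto L).comp hconv
    rwa [← hw, hinv] at h
  refine (isClosed_smallCone _).mem_of_tendsto hlim ?_
  filter_upwards [eventually_ge_atTop k] with N hN
  obtain ⟨d, rfl⟩ := Nat.exists_eq_add_of_le hN
  obtain ⟨x, hx, h⟩ := exists_barSeq_eq_mulVec hK k d (e3_mem_smallCone _)
  rw [h, hinv]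
  exact hx

/-- Lemma 1 of Keane: if `B_k w = L` with `w ≥ 0` (so the entries of `w` are the Lebesgue
measures of the subintervals of the `k`-th induced interval), then
`w₂/|w|₁ ≤ 2m_k/((n_{k+1}+1)(n_k+1))`. -/
theorem lemma_one (m n : ℕ → ℕ) (hK : KeaneCond m n)
    (L : Fin 4 → ℝ)
    (hconv : Tendsto (fun k => barSeq m n k e3) atTop (𝓝 L)) :
    ∀ k, 1 ≤ k → ∀ w : Fin 4 → ℝ, (∀ i, 0 ≤ w i) → Bmat m n k *ᵥ w = L →
      w 1 / l1norm w ≤ 2 * (m k : ℝ) / (((n (k + 1) : ℝ) + 1) * ((n k : ℝ) + 1)) := by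
  intro k hk w hw hBw
  obtain ⟨-, -, h⟩ := mem_smallCone_of_Bmat_mulVec_eq hK hconv hBw
  have hS : l1norm w = w 0 + w 1 + w 2 + w 3 := by
    simp [l1norm, Fin.sum_univ_four, abs_of_nonneg (hw _)]
  rw [← hS] at h
  have hm : 3 * ((n k : ℝ) + 1) ≤ m k := by exact_mod_cast (hK.2.1 k hk).1
  have hn : (0 : ℝ) < n k + 1 := by positivity
  have hn' : (0 : ℝ) < n (k + 1) + 1 := by positivity
  refine div_le_of_le_mul₀ (l1norm_nonneg w) (by positivity) ?_
  rw [div_mul_eq_mul_div, le_div_iff₀ (mul_pos hn' hn)]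
  calc w 1 * (((n (k + 1) : ℝ) + 1) * ((n k : ℝ) + 1))
      = (((n (k + 1) : ℝ) + 1) * w 1) * ((n k : ℝ) + 1) := by ring
    _ ≤ l1norm w * ((n k : ℝ) + 1) := mul_le_mul_of_nonneg_right h hn.le
    _ ≤ l1norm w * (2 * m k) := mul_le_mul_of_nonneg_left (by linarith) (l1norm_nonneg w)
    _ = 2 * m k * l1norm w := mul_comm _ _
end
end

section
/- Let n_k = 9^(4^(k−1)) and m_k = 9^(4^(k−1)+k) for k ≥ 1. Then for every k ≥ 1, 9^((4^k−1)/3 + k(k+1)/2) ≤ b_{k,2} ≤ 2^k · 9^((4^k−1)/3 + k(k+1)/2). -/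
open MeasureTheory Filter Set Matrix Topology

noncomputable section

lemma Amat_nonneg {m n : ℕ} (hm : 1 ≤ m) (hn : 1 ≤ n) (i j : Fin 4) : 0 ≤ Amat m n i j := by
  have hm' : (1 : ℝ) ≤ m := by exact_mod_cast hm
  have hn' : (1 : ℝ) ≤ n := by exact_mod_cast hn
  fin_cases i <;> fin_cases j <;> simp [Amat] <;> linarith

lemma Bmat_nonneg {m n : ℕ → ℕ} (hm : ∀ k, 1 ≤ k → 1 ≤ m k) (hn : ∀ k, 1 ≤ k → 1 ≤ n k)
    (k : ℕ) (i j : Fin 4) : 0 ≤ Bmat m n k i j := by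
  induction k generalizing i j with
  | zero =>
    simp only [Bmat, List.range_zero, List.map_nil, List.prod_nil, Matrix.one_apply]
    split_ifs <;> norm_num
  | succ k ih =>
    rw [Bmat_succ, Matrix.mul_apply]
    exact Finset.sum_nonneg fun l _ => mul_nonneg (ih i l)
      (Amat_nonneg (hm _ (Nat.le_add_left 1 k)) (hn _ (Nat.le_add_left 1 k)) l j)

lemma bnum_nonneg (m n : ℕ → ℕ) (k : ℕ) (i : Fin 4) : 0 ≤ bnum m n k i := by
  unfold bnum l1norm
  exact Finset.sum_nonneg fun _ _ => abs_nonneg _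

lemma bnum_zero (m n : ℕ → ℕ) (i : Fin 4) : bnum m n 0 i = 1 := by
  fin_cases i <;> simp [bnum, l1norm, Bmat, Fin.sum_univ_four]

/-- The column sums of `B_{k+1}` are obtained from those of `B_k` by multiplying with
`A_{m_{k+1},n_{k+1}}` on the right. -/
lemma bnum_succ {m n : ℕ → ℕ} (hm : ∀ k, 1 ≤ k → 1 ≤ m k) (hn : ∀ k, 1 ≤ k → 1 ≤ n k)
    (k : ℕ) (i : Fin 4) :
    bnum m n (k + 1) i = ∑ l, bnum m n k l * Amat (m (k + 1)) (n (k + 1)) l i := by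
  have hB : ∀ k i, bnum m n k i = ∑ j, Bmat m n k j i := fun k i => by
    unfold bnum l1norm
    exact Finset.sum_congr rfl fun j _ => abs_of_nonneg (Bmat_nonneg hm hn k j i)
  simp only [hB, Bmat_succ, Matrix.mul_apply, Finset.sum_mul]
  exact Finset.sum_comm

lemma bnum_succ_one {m n : ℕ → ℕ} (hm : ∀ k, 1 ≤ k → 1 ≤ m k) (hn : ∀ k, 1 ≤ k → 1 ≤ n k)
    (k : ℕ) :
    bnum m n (k + 1) 1 =
      m (k + 1) * bnum m n k 1 + n (k + 1) * bnum m n k 2 + bnum m n k 3 := by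
  rw [bnum_succ hm hn, Fin.sum_univ_four]
  simp [Amat]
  ring

lemma bnum_column_comparison {m n : ℕ → ℕ} (hm : ∀ k, 1 ≤ k → 1 ≤ m k)
    (hn : ∀ k, 1 ≤ k → 2 ≤ n k) (k : ℕ) :
    bnum m n k 0 ≤ bnum m n k 1 ∧ bnum m n k 2 ≤ bnum m n k 1 ∧
      bnum m n k 3 ≤ 2 * bnum m n k 2 := by
  have hn₁ : ∀ k, 1 ≤ k → 1 ≤ n k := fun k hk => one_le_two.trans (hn k hk)
  induction k with
  | zero => norm_num [bnum_zero]
  | succ k ih =>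
    obtain ⟨h₀, -, -⟩ := ih
    have hm' : (1 : ℝ) ≤ m (k + 1) := by exact_mod_cast hm _ (Nat.le_add_left 1 k)
    have hn' : (2 : ℝ) ≤ n (k + 1) := by exact_mod_cast hn _ (Nat.le_add_left 1 k)
    have p₀ := bnum_nonneg m n k 0
    have p₁ := bnum_nonneg m n k 1
    have p₂ := bnum_nonneg m n k 2
    have p₃ := bnum_nonneg m n k 3
    have hmul₁ := mul_le_mul_of_nonneg_right hm' p₁
    have hmul₂ := mul_le_mul_of_nonneg_right hn' p₂
    simp only [bnum_succ hm hn₁, Fin.sum_univ_four]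
    simp [Amat]
    refine ⟨?_, ?_, ?_⟩ <;> linarith

/-- One multiplication by `A_{m,n}` with `9 n ≤ m` scales the second column sum by a factor
between `m` and `2 m`. -/
lemma bnum_succ_one_bounds {m n : ℕ → ℕ} (hn : ∀ k, 1 ≤ k → 2 ≤ n k)
    (hmn : ∀ k, 1 ≤ k → 9 * n k ≤ m k) (k : ℕ) :
    m (k + 1) * bnum m n k 1 ≤ bnum m n (k + 1) 1 ∧
      bnum m n (k + 1) 1 ≤ 2 * (m (k + 1) * bnum m n k 1) := by
  have hm : ∀ k, 1 ≤ k → 1 ≤ m k := fun k hk => by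
    have := hn k hk
    have := hmn k hk
    omega
  obtain ⟨-, h₂, h₃⟩ := bnum_column_comparison hm hn k
  have hn' : (2 : ℝ) ≤ n (k + 1) := by exact_mod_cast hn _ (Nat.le_add_left 1 k)
  have hmn' : 9 * (n (k + 1) : ℝ) ≤ m (k + 1) := by exact_mod_cast hmn _ (Nat.le_add_left 1 k)
  have p₁ := bnum_nonneg m n k 1
  have p₂ := bnum_nonneg m n k 2
  have p₃ := bnum_nonneg m n k 3
  rw [bnum_succ_one hm fun k hk => one_le_two.trans (hn k hk)]
  have hmul₂ : (n (k + 1) : ℝ) * bnum m n k 2 ≤ n (k + 1) * bnum m n k 1 := by gcongr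
  have hmul₁ := mul_le_mul_of_nonneg_right hmn' p₁
  have hn₁ := mul_le_mul_of_nonneg_right hn' p₁
  have hn₂ : 0 ≤ (n (k + 1) : ℝ) * bnum m n k 2 := by positivity
  constructor <;> linarith

/-- For `n_k = 9^(4^(k−1))` and `m_k = 9^(4^(k−1)+k)` one has
`9^((4^k−1)/3 + k(k+1)/2) ≤ b_{k,2} ≤ 2^k 9^((4^k−1)/3 + k(k+1)/2)`, where
`(4^k−1)/3 = 1 + 4 + ⋯ + 4^(k−1)` and `k(k+1)/2 = 1 + 2 + ⋯ + k`. -/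
theorem b_estimate (m n : ℕ → ℕ)
    (hm : ∀ k, 1 ≤ k → m k = 9 ^ (4 ^ (k - 1) + k))
    (hn : ∀ k, 1 ≤ k → n k = 9 ^ (4 ^ (k - 1))) :
    ∀ k, 1 ≤ k →
      (9 : ℝ) ^ ((∑ i ∈ Finset.range k, 4 ^ i) + ∑ i ∈ Finset.Icc 1 k, i) ≤ bnum m n k 1 ∧
      bnum m n k 1 ≤
        (2 : ℝ) ^ k * (9 : ℝ) ^ ((∑ i ∈ Finset.range k, 4 ^ i) + ∑ i ∈ Finset.Icc 1 k, i) := by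
  have hn₂ : ∀ k, 1 ≤ k → 2 ≤ n k := fun k hk => by
    rw [hn k hk]
    exact (by norm_num : 2 ≤ 9).trans (Nat.le_self_pow (by positivity) 9)
  have hmn : ∀ k, 1 ≤ k → 9 * n k ≤ m k := fun k hk => by
    rw [hn k hk, hm k hk, ← pow_succ']
    exact Nat.pow_le_pow_right (by norm_num) (by omega)
  rintro k -
  induction k with
  | zero => simp [bnum_zero]
  | succ k ih =>
    obtain ⟨hl, hu⟩ := ih
    obtain ⟨h₁, h₂⟩ := bnum_succ_one_bounds hn₂ hmn k
    have hmk : (m (k + 1) : ℝ) = 9 ^ (4 ^ k + (k + 1)) := by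
      rw [hm _ (Nat.le_add_left 1 k)]
      simp
    have hpow : (9 : ℝ) ^ ((∑ i ∈ Finset.range (k + 1), 4 ^ i) + ∑ i ∈ Finset.Icc 1 (k + 1), i) =
        m (k + 1) * 9 ^ ((∑ i ∈ Finset.range k, 4 ^ i) + ∑ i ∈ Finset.Icc 1 k, i) := by
      rw [hmk, Finset.sum_range_succ, Finset.sum_Icc_succ_top (Nat.le_add_left 1 k), ← pow_add]
      congr 1
      ring
    rw [hpow]
    constructor
    · exact (mul_le_mul_of_nonneg_left hl (Nat.cast_nonneg _)).trans h₁
    · calc _ ≤ _ := h₂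
        _ ≤ _ := mul_le_mul_of_nonneg_left
            (mul_le_mul_of_nonneg_left hu (Nat.cast_nonneg _)) zero_le_two
        _ = _ := by ring
end
end
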